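/- There is an effective procedure (a total computable function on Gödel numbers) that, given a Gödel number of a recursively enumerable set Σ of 𝓛-sentences, outputs a Gödel number of the recursively enumerable set {φ : Σ ⊨ φ}. -/

import Mathlib

/-!
Formalization of the framework of "A machine that knows its own code" (S. Alexander).

The language 𝓛 is the language of Peano arithmetic (constant `0`, unary successor `S`,
binary `+` and `·`) extended by a unary modal operator `K`.
-/

/-- Terms of the language 𝓛 of Peano arithmetic (variables are indexed by `ℕ`). -/
inductive LTerm : Type
  | var : ℕ → LTerm
  | zero : LTerm
  | succ : LTerm → LTerm
  | add : LTerm → LTerm → LTerm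
  | mul : LTerm → LTerm → LTerm
  deriving DecidableEq

/-- Formulas of 𝓛: atomic equalities, falsum, implication, universal quantification,
and the modal operator `K`.  Other connectives and `∃` are defined below. -/
inductive LFormula : Type
  | eq : LTerm → LTerm → LFormula
  | falsum : LFormula
  | imp : LFormula → LFormula → LFormula
  | all : ℕ → LFormula → LFormula
  | K : LFormula → LFormula
  deriving DecidableEq

namespace LTerm

/-- Variables occurring in a term. -/
def fv : LTerm → Finset ℕ
  | var n => {n}
  | zero => ∅
  | succ t => t.fv
  | add t u => t.fv ∪ u.fv
  | mul t u => t.fv ∪ u.fv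

/-- Simultaneous substitution of terms for variables in a term. -/
def subst (s : ℕ → LTerm) : LTerm → LTerm
  | var n => s n
  | zero => zero
  | succ t => succ (t.subst s)
  | add t u => add (t.subst s) (u.subst s)
  | mul t u => mul (t.subst s) (u.subst s)

end LTerm

/-- The numeral `n̄` for a natural number `n`. -/
def numeral : ℕ → LTerm
  | 0 => LTerm.zero
  | n + 1 => LTerm.succ (numeral n)

namespace LFormula

/-- The free variables of a formula (the free variables of `K φ` are those of `φ`). -/
def fv : LFormula → Finset ℕ
  | eq t u => t.fv ∪ u.fv
  | falsum => ∅
  | imp a b => a.fv ∪ b.fv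
  | all x a => a.fv.erase x
  | K a => a.fv

/-- Simultaneous substitution of terms for the *free* variables of a formula
(bound variables are left untouched; the substitution is not capture-avoiding). -/
def subst (s : ℕ → LTerm) : LFormula → LFormula
  | eq t u => eq (t.subst s) (u.subst s)
  | falsum => falsum
  | imp a b => imp (a.subst s) (b.subst s)
  | all x a => all x (a.subst fun z => if z = x then LTerm.var x else s z)
  | K a => K (a.subst s)

end LFormula

/-- `subst1 x t φ` is `φ(x|t)`, the result of substituting the term `t` for the free
occurrences of the variable `x` in `φ`. -/
def subst1 (x : ℕ) (t : LTerm) (φ : LFormula) : LFormula :=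
  φ.subst fun z => if z = x then t else LTerm.var z

/-- `instNum s φ` is `φ^s`: the sentence obtained from `φ` by replacing each free
variable `x` of `φ` by the numeral for `s x`. -/
def instNum (s : ℕ → ℕ) (φ : LFormula) : LFormula :=
  φ.subst fun z => numeral (s z)

/-- `SubstitutableVar y x φ`: the variable `y` is substitutable for the variable `x`
in `φ` (no free occurrence of `x` lies within the scope of a quantifier binding `y`). -/
def SubstitutableVar (y x : ℕ) : LFormula → Prop
  | .eq _ _ => True
  | .falsum => True
  | .imp a b => SubstitutableVar y x a ∧ SubstitutableVar y x b
  | .all z a => x ∉ (LFormula.all z a).fv ∨ (y ≠ z ∧ SubstitutableVar y x a)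
  | .K a => SubstitutableVar y x a

/-- Correspondence of variables relative to a list of pairs of bound variables. -/
def VarCorr : List (ℕ × ℕ) → ℕ → ℕ → Prop
  | [], x, y => x = y
  | (a, b) :: Γ, x, y => (x = a ∧ y = b) ∨ (x ≠ a ∧ y ≠ b ∧ VarCorr Γ x y)

/-- Alpha-correspondence of terms relative to a list of pairs of bound variables. -/
def TermAlpha (Γ : List (ℕ × ℕ)) : LTerm → LTerm → Prop
  | .var x, .var y => VarCorr Γ x y
  | .zero, .zero => True
  | .succ t, .succ u => TermAlpha Γ t u
  | .add t₁ t₂, .add u₁ u₂ => TermAlpha Γ t₁ u₁ ∧ TermAlpha Γ t₂ u₂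
  | .mul t₁ t₂, .mul u₁ u₂ => TermAlpha Γ t₁ u₁ ∧ TermAlpha Γ t₂ u₂
  | _, _ => False

/-- Alpha-correspondence of formulas relative to a list of pairs of bound variables. -/
def FormulaAlpha : List (ℕ × ℕ) → LFormula → LFormula → Prop
  | Γ, .eq t₁ t₂, .eq u₁ u₂ => TermAlpha Γ t₁ u₁ ∧ TermAlpha Γ t₂ u₂
  | _, .falsum, .falsum => True
  | Γ, .imp a₁ a₂, .imp b₁ b₂ => FormulaAlpha Γ a₁ b₁ ∧ FormulaAlpha Γ a₂ b₂
  | Γ, .all x a, .all y b => FormulaAlpha ((x, y) :: Γ) a b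
  | Γ, .K a, .K b => FormulaAlpha Γ a b
  | _, _, _ => False

/-- `ψ` is an alphabetic variant of `φ`: `ψ` is obtained from `φ` by renaming bound
variables so as to respect the binding of the quantifiers. -/
def AlphaVariant (φ ψ : LFormula) : Prop := FormulaAlpha [] φ ψ

/-- Negation, defined from `→` and `⊥`. -/
def notF (φ : LFormula) : LFormula := LFormula.imp φ LFormula.falsum

/-- Conjunction (defined connective). -/
def andF (φ ψ : LFormula) : LFormula := notF (LFormula.imp φ (notF ψ))

/-- Biconditional (defined connective). -/
def iffF (φ ψ : LFormula) : LFormula := andF (LFormula.imp φ ψ) (LFormula.imp ψ φ)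

/-- Existential quantification (defined). -/
def exF (x : ℕ) (φ : LFormula) : LFormula := notF (LFormula.all x (notF φ))

/-- A canonical universal closure of a formula. -/
def uclose (φ : LFormula) : LFormula :=
  (φ.fv.sort (· ≤ ·)).foldr LFormula.all φ

/-- An 𝓛-structure: a first-order structure for the first-order part of 𝓛, together
with a truth assignment `satK s φ` for the purely modal formulas `K φ` at each
assignment `s` into the universe (the three required constraints are singled out
in `IsLStructure` below). -/
structure LStructure where
  U : Type
  nonempty : Nonempty U
  zero : U
  succ : U → U
  add : U → U → U
  mul : U → U → U
  satK : (ℕ → U) → LFormula → Prop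

namespace LStructure

/-- Value of a term under an assignment. -/
def evalT (M : LStructure) (s : ℕ → M.U) : LTerm → M.U
  | .var n => s n
  | .zero => M.zero
  | .succ t => M.succ (M.evalT s t)
  | .add t u => M.add (M.evalT s t) (M.evalT s u)
  | .mul t u => M.mul (M.evalT s t) (M.evalT s u)

/-- Satisfaction `M ⊨ φ[s]`, defined by the usual induction on formula complexity,
with `M ⊨ (K φ)[s]` given by the structure's truth assignment `satK`. -/
def Sat (M : LStructure) : (ℕ → M.U) → LFormula → Prop
  | s, .eq t u => M.evalT s t = M.evalT s u
  | _, .falsum => False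
  | s, .imp a b => M.Sat s a → M.Sat s b
  | s, .all x a => ∀ u : M.U, M.Sat (Function.update s x u) a
  | s, .K a => M.satK s a

/-- `M ⊨ φ`: `M ⊨ φ[s]` for every assignment `s`. -/
def Models (M : LStructure) (φ : LFormula) : Prop := ∀ s : ℕ → M.U, M.Sat s φ

end LStructure

/-- The three constraints making an `LStructure` a genuine 𝓛-structure of the base
logic: (a) `satK s φ` depends only on the values of `s` on the free variables of `φ`;
(b) invariance under alphabetic variants; (c) weak substitution. -/
def IsLStructure (M : LStructure) : Prop :=
  (∀ (φ : LFormula) (s t : ℕ → M.U), (∀ x ∈ φ.fv, s x = t x) →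
      (M.satK s φ ↔ M.satK t φ)) ∧
  (∀ (φ ψ : LFormula) (s : ℕ → M.U), AlphaVariant φ ψ →
      (M.satK s φ ↔ M.satK s ψ)) ∧
  (∀ (φ : LFormula) (x y : ℕ) (s : ℕ → M.U), SubstitutableVar y x φ →
      (M.satK s (subst1 x (LTerm.var y) φ) ↔ M.satK (Function.update s x (s y)) φ))

/-- `Σ ⊨ φ`: every 𝓛-structure satisfying every member of `Σ` satisfies `φ`. -/
def Consequence (T : Set LFormula) (φ : LFormula) : Prop :=
  ∀ M : LStructure, IsLStructure M → (∀ σ ∈ T, M.Models σ) → M.Models φ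

/-- `φ` is valid: `∅ ⊨ φ`, i.e. `φ` holds in every 𝓛-structure under every assignment. -/
def Valid (φ : LFormula) : Prop := Consequence ∅ φ

/-- The structure `M_Σ`: universe `ℕ`, standard interpretations of the symbols of
Peano arithmetic, and `M_Σ ⊨ (K φ)[s]` iff `Σ ⊨ φ^s`. -/
def MSigma (T : Set LFormula) : LStructure where
  U := ℕ
  nonempty := ⟨0⟩
  zero := 0
  succ := Nat.succ
  add := (· + ·)
  mul := (· * ·)
  satK := fun s φ => Consequence T (instNum s φ)

/-- Instances of the schema `E1`: the universal closure of `K φ` for valid `φ`. -/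
def E1set : Set LFormula :=
  {χ | ∃ φ : LFormula, Valid φ ∧ χ = uclose (LFormula.K φ)}

/-- Instances of the schema `E2`: the universal closure of `K(φ → ψ) → K φ → K ψ`. -/
def E2set : Set LFormula :=
  {χ | ∃ φ ψ : LFormula,
    χ = uclose (LFormula.imp (LFormula.K (LFormula.imp φ ψ))
      (LFormula.imp (LFormula.K φ) (LFormula.K ψ)))}

/-- Instances of the schema `E3` (factivity): the universal closure of `K φ → φ`. -/
def E3set : Set LFormula :=
  {χ | ∃ φ : LFormula, χ = uclose (LFormula.imp (LFormula.K φ) φ)}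

/-- Instances of the schema `E4`: the universal closure of `K φ → K K φ`. -/
def E4set : Set LFormula :=
  {χ | ∃ φ : LFormula, χ = uclose (LFormula.imp (LFormula.K φ) (LFormula.K (LFormula.K φ)))}

/-- The axioms of Peano arithmetic for 𝓛: the six usual axioms for successor,
addition and multiplication, and the induction schema extended to all 𝓛-formulas. -/
inductive PAax : LFormula → Prop
  | succ_ne_zero : PAax (.all 0 (notF (.eq (.succ (.var 0)) .zero)))
  | succ_inj : PAax (.all 0 (.all 1 (.imp (.eq (.succ (.var 0)) (.succ (.var 1)))
      (.eq (.var 0) (.var 1)))))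
  | add_zero : PAax (.all 0 (.eq (.add (.var 0) .zero) (.var 0)))
  | add_succ : PAax (.all 0 (.all 1 (.eq (.add (.var 0) (.succ (.var 1)))
      (.succ (.add (.var 0) (.var 1))))))
  | mul_zero : PAax (.all 0 (.eq (.mul (.var 0) .zero) .zero))
  | mul_succ : PAax (.all 0 (.all 1 (.eq (.mul (.var 0) (.succ (.var 1)))
      (.add (.mul (.var 0) (.var 1)) (.var 0)))))
  | ind (φ : LFormula) (x : ℕ) :
      PAax (uclose (.imp (subst1 x .zero φ)
        (.imp (.all x (.imp φ (subst1 x (.succ (.var x)) φ))) (.all x φ))))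

/-- The set of axioms of Peano arithmetic for 𝓛. -/
def PAset : Set LFormula := {φ | PAax φ}

/-- `W e`: the `e`-th recursively enumerable subset of `ℕ` (the domain of the `e`-th
partial computable function). -/
def W (e : ℕ) : Set ℕ :=
  {m | ((Denumerable.ofNat Nat.Partrec.Code e).eval m).Dom}

namespace LTerm

/-- A canonical Gödel numbering of terms. -/
def gnum : LTerm → ℕ
  | var n => Nat.pair 0 n
  | zero => Nat.pair 1 0
  | succ t => Nat.pair 2 t.gnum
  | add t u => Nat.pair 3 (Nat.pair t.gnum u.gnum)
  | mul t u => Nat.pair 4 (Nat.pair t.gnum u.gnum)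

end LTerm

namespace LFormula

/-- A canonical Gödel numbering `⌜φ⌝` of formulas. -/
def gnum : LFormula → ℕ
  | eq t u => Nat.pair 0 (Nat.pair t.gnum u.gnum)
  | falsum => Nat.pair 1 0
  | imp a b => Nat.pair 2 (Nat.pair a.gnum b.gnum)
  | all x a => Nat.pair 3 (Nat.pair x a.gnum)
  | K a => Nat.pair 4 a.gnum

end LFormula

/-- The designated variable `x`. -/
def vx : ℕ := 0
/-- The designated variable `y` (second pairing argument). -/
def vy : ℕ := 1
/-- The designated variable `e` (r.e. index). -/
def ve : ℕ := 2

/-- A formula is `K`-free (purely first-order) if the operator `K` does not occur in it. -/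
def KFree : LFormula → Prop
  | .eq _ _ => True
  | .falsum => True
  | .imp a b => KFree a ∧ KFree b
  | .all _ a => KFree a
  | .K _ => False

/-- The standard structure: universe `ℕ` with the standard interpretations of the
symbols of Peano arithmetic (the modal component is irrelevant for `K`-free formulas). -/
def StdModel : LStructure where
  U := ℕ
  nonempty := ⟨0⟩
  zero := 0
  succ := Nat.succ
  add := (· + ·)
  mul := (· * ·)
  satK := fun _ _ => False

/-- `pwNum pw a b k`: the result of substituting the numerals `ā`, `b̄`, `k̄` for the
designated variables `x`, `y`, `e` in the formula `pw` (read: `⟨ā, b̄⟩ ∈ W_k̄`). -/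
def pwNum (pw : LFormula) (a b k : ℕ) : LFormula :=
  instNum (fun z => if z = vx then a else if z = vy then b else k) pw

/-- `wNum w a k`: the result of substituting the numerals `ā`, `k̄` for the designated
variables `x`, `e` in the formula `w` (read: `ā ∈ W_k̄`). -/
def wNum (w : LFormula) (a k : ℕ) : LFormula :=
  instNum (fun z => if z = vx then a else k) w

/-- Line 3 of the definition of `Σ(n)`: the sentence
`∀x (K φ ↔ ⟨x, ⌜φ⌝⟩ ∈ W_n̄)`, where `pw` is the formula (with designated free
variables `x`, `y`, `e`) expressing `⟨x, y⟩ ∈ W_e`. -/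
def line3 (pw : LFormula) (n : ℕ) (φ : LFormula) : LFormula :=
  LFormula.all vx (iffF (LFormula.K φ)
    (subst1 ve (numeral n) (subst1 vy (numeral φ.gnum) pw)))

/-- Membership in the axiom set `Σ(n)` (relative to the formula `pw` expressing
`⟨x, y⟩ ∈ W_e`): (1) instances of `E1`, `E2`, `E4`; (2) the axioms of Peano
arithmetic for 𝓛; (3) `∀x (K φ ↔ ⟨x, ⌜φ⌝⟩ ∈ W_n̄)` for `φ` with free variables
⊆ {x}; (4) assigned validity `φ^s` for valid `φ`; (5) `K φ` for `φ` an instance of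
lines 1–4 or, recursively, of line 5. -/
inductive SigmaAx (pw : LFormula) (n : ℕ) : LFormula → Prop
  | e1 {χ : LFormula} (h : χ ∈ E1set) : SigmaAx pw n χ
  | e2 {χ : LFormula} (h : χ ∈ E2set) : SigmaAx pw n χ
  | e4 {χ : LFormula} (h : χ ∈ E4set) : SigmaAx pw n χ
  | pa {χ : LFormula} (h : PAax χ) : SigmaAx pw n χ
  | code (φ : LFormula) (h : φ.fv ⊆ {vx}) : SigmaAx pw n (line3 pw n φ)
  | av (φ : LFormula) (s : ℕ → ℕ) (h : Valid φ) : SigmaAx pw n (instNum s φ)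
  | k {φ : LFormula} (h : SigmaAx pw n φ) : SigmaAx pw n (LFormula.K φ)

/-- The axiom set `Σ(n)` (relative to `pw`). -/
def SigmaN (pw : LFormula) (n : ℕ) : Set LFormula := {φ | SigmaAx pw n φ}

/-- The set `{ ⟨m, ⌜φ⌝⟩ : φ an 𝓛-formula with free variables ⊆ {x} and
Σ(n) ⊨ φ(x|m̄) }`. -/
def goalSet (pw : LFormula) (n : ℕ) : Set ℕ :=
  {p | ∃ (m : ℕ) (φ : LFormula), p = Nat.pair m φ.gnum ∧ φ.fv ⊆ {vx} ∧
    Consequence (SigmaN pw n) (subst1 vx (numeral m) φ)}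

/-! ### Propositional clauses axiomatizing 𝓛-structures

Consequence is reduced to the unsatisfiability of a recursive set of propositional clauses
over atoms coded by natural numbers.  The atoms speak about closures, i.e. pairs of a
formula and an environment mapping variables to parameters.  Auxiliary Horn clauses describe
agreement of environments, alphabetic variants and substitution. -/

/-- Types with a pairing operation and literals for the natural numbers. -/
class PairAlg (α : Type) where
  pr : α → α → α
  lit : ℕ → α

namespace PairAlg

instance : PairAlg ℕ := ⟨Nat.pair, id⟩

variable {α : Type} [PairAlg α]

/-- The code of a compound object with constructor number `i`. -/
abbrev tag (i : ℕ) (a : α) : α := pr (lit i) a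

/-- Code of a variable. -/
abbrev cVar (x : α) : α := tag 0 x
/-- Code of the term `0`. -/
abbrev cZero : α := tag 1 (lit 0)
/-- Code of a successor term. -/
abbrev cSucc (t : α) : α := tag 2 t
/-- Code of a sum. -/
abbrev cAdd (t u : α) : α := tag 3 (pr t u)
/-- Code of a product. -/
abbrev cMul (t u : α) : α := tag 4 (pr t u)
/-- Code of an equation. -/
abbrev cEq (t u : α) : α := tag 0 (pr t u)
/-- Code of falsum. -/
abbrev cFalsum : α := tag 1 (lit 0)
/-- Code of an implication. -/
abbrev cImp (a b : α) : α := tag 2 (pr a b)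
/-- Code of a universal quantification. -/
abbrev cAll (x a : α) : α := tag 3 (pr x a)
/-- Code of a purely modal formula. -/
abbrev cK (a : α) : α := tag 4 a
/-- The empty environment (or list of pairs of bound variables). -/
abbrev eNil : α := tag 0 (lit 0)
/-- The environment `ρ` updated to send the variable `x` to the parameter `p`. -/
abbrev eCons (x p ρ : α) : α := tag 1 (pr (pr x p) ρ)
/-- The parameter denoting zero. -/
abbrev pZero : α := tag 1 (lit 0)
/-- The parameter denoting a successor. -/
abbrev pSucc (p : α) : α := tag 2 p
/-- The parameter denoting a sum. -/
abbrev pAdd (p q : α) : α := tag 3 (pr p q)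
/-- The parameter denoting a product. -/
abbrev pMul (p q : α) : α := tag 4 (pr p q)
/-- The Henkin parameter of the formula `∀ x, a` in the environment `ρ`. -/
abbrev pHen (x a ρ : α) : α := tag 5 (pr x (pr a ρ))
/-- The parameter denoting the value of the term `t` in the environment `ρ`. -/
abbrev pClos (t ρ : α) : α := tag 6 (pr t ρ)

/-- Atom: the formula `a` holds in the environment `ρ`. -/
abbrev aTr (a ρ : α) : α := tag 0 (pr a ρ)
/-- Atom: the parameters `p` and `q` are equal. -/
abbrev aEqv (p q : α) : α := tag 1 (pr p q)
/-- Atom: `ρ` and `σ` agree on the variables of the term `t`. -/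
abbrev aAgT (t ρ σ : α) : α := tag 2 (pr t (pr ρ σ))
/-- Atom: `ρ` and `σ` agree on the free variables of the formula `a`. -/
abbrev aAgF (a ρ σ : α) : α := tag 3 (pr a (pr ρ σ))
/-- Atom: correspondence of variables relative to `Γ`. -/
abbrev aVC (Γ x y : α) : α := tag 4 (pr Γ (pr x y))
/-- Atom: alpha-correspondence of terms relative to `Γ`. -/
abbrev aTA (Γ t u : α) : α := tag 5 (pr Γ (pr t u))
/-- Atom: alpha-correspondence of formulas relative to `Γ`. -/
abbrev aFA (Γ a b : α) : α := tag 6 (pr Γ (pr a b))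
/-- Atom: `u` results from substituting the variable `y` for `x` in the term `t`. -/
abbrev aST (x y t u : α) : α := tag 7 (pr (pr x y) (pr t u))
/-- Atom: `y` is substitutable for `x` in the formula `a`, and `b` is the result. -/
abbrev aSF (x y a b : α) : α := tag 8 (pr (pr x y) (pr a b))

end PairAlg

open PairAlg

/-- Hypotheses of a clause: an atom is true, an atom is false, two codes differ. -/
inductive Hyp (α : Type)
  | T : α → Hyp α
  | F : α → Hyp α
  | ne : α → α → Hyp α

/-- `Hyp.Sat v h`: the hypothesis `h` is satisfied by the valuation `v`. -/
def Hyp.Sat (v : ℕ → Prop) : Hyp ℕ → Prop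
  | T p => v p
  | F p => ¬ v p
  | ne p q => p ≠ q

/-- `clauseHolds v hs c`: if all the hypotheses `hs` are satisfied by `v` then so is `c`. -/
def clauseHolds (v : ℕ → Prop) : List (Hyp ℕ) → Option ℕ → Prop
  | [], none => False
  | [], some p => v p
  | h :: hs, c => h.Sat v → clauseHolds v hs c

/-- Names of the clauses. -/
inductive Rule
  | eqvRefl | eqvSymm | eqvTrans | eqvSucc | eqvAdd | eqvMul
  | closHit | closMiss | closZero | closSucc | closAdd | closMul
  | agVar | agZero | agSucc | agAdd | agMul
  | agEq | agFalsum | agImp | agAll | agK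
  | vcNil | vcHit | vcMiss
  | taVar | taZero | taSucc | taAdd | taMul
  | faEq | faFalsum | faImp | faAll | faK
  | stHit | stMiss | stZero | stSucc | stAdd | stMul
  | sfEq | sfFalsum | sfImp | sfBound | sfFresh | sfAll | sfK
  | trEq | trEq' | trFalsum | trMp | trImp | trImp' | trAll | trHenkin
  | trAgree | trAlpha | trAlpha' | trSubst | trSubst'
  deriving DecidableEq

open Hyp in
/-- The clause with a given name, instantiated at the given codes. -/
def Rule.clause {α : Type} [PairAlg α] (a b c d e f : α) : Rule → List (Hyp α) × Option α
  | eqvRefl => ([], some (aEqv a a))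
  | eqvSymm => ([T (aEqv a b)], some (aEqv b a))
  | eqvTrans => ([T (aEqv a b), T (aEqv b c)], some (aEqv a c))
  | eqvSucc => ([T (aEqv a b)], some (aEqv (pSucc a) (pSucc b)))
  | eqvAdd => ([T (aEqv a b), T (aEqv c d)], some (aEqv (pAdd a c) (pAdd b d)))
  | eqvMul => ([T (aEqv a b), T (aEqv c d)], some (aEqv (pMul a c) (pMul b d)))
  | closHit => ([], some (aEqv (pClos (cVar a) (eCons a b c)) b))
  | closMiss => ([ne d a], some (aEqv (pClos (cVar d) (eCons a b c)) (pClos (cVar d) c)))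
  | closZero => ([], some (aEqv (pClos cZero a) pZero))
  | closSucc => ([], some (aEqv (pClos (cSucc a) b) (pSucc (pClos a b))))
  | closAdd => ([], some (aEqv (pClos (cAdd a b) c) (pAdd (pClos a c) (pClos b c))))
  | closMul => ([], some (aEqv (pClos (cMul a b) c) (pMul (pClos a c) (pClos b c))))
  | agVar => ([T (aEqv (pClos (cVar a) b) (pClos (cVar a) c))], some (aAgT (cVar a) b c))
  | agZero => ([], some (aAgT cZero a b))
  | agSucc => ([T (aAgT a b c)], some (aAgT (cSucc a) b c))
  | agAdd => ([T (aAgT a c d), T (aAgT b c d)], some (aAgT (cAdd a b) c d))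
  | agMul => ([T (aAgT a c d), T (aAgT b c d)], some (aAgT (cMul a b) c d))
  | agEq => ([T (aAgT a c d), T (aAgT b c d)], some (aAgF (cEq a b) c d))
  | agFalsum => ([], some (aAgF cFalsum a b))
  | agImp => ([T (aAgF a c d), T (aAgF b c d)], some (aAgF (cImp a b) c d))
  | agAll => ([T (aAgF b (eCons a e c) (eCons a e d))], some (aAgF (cAll a b) c d))
  | agK => ([T (aAgF a b c)], some (aAgF (cK a) b c))
  | vcNil => ([], some (aVC eNil a a))
  | vcHit => ([], some (aVC (eCons a b c) a b))
  | vcMiss => ([ne d a, ne e b, T (aVC c d e)], some (aVC (eCons a b c) d e))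
  | taVar => ([T (aVC a b c)], some (aTA a (cVar b) (cVar c)))
  | taZero => ([], some (aTA a cZero cZero))
  | taSucc => ([T (aTA a b c)], some (aTA a (cSucc b) (cSucc c)))
  | taAdd => ([T (aTA a b c), T (aTA a d e)], some (aTA a (cAdd b d) (cAdd c e)))
  | taMul => ([T (aTA a b c), T (aTA a d e)], some (aTA a (cMul b d) (cMul c e)))
  | faEq => ([T (aTA a b c), T (aTA a d e)], some (aFA a (cEq b d) (cEq c e)))
  | faFalsum => ([], some (aFA a cFalsum cFalsum))
  | faImp => ([T (aFA a b c), T (aFA a d e)], some (aFA a (cImp b d) (cImp c e)))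
  | faAll => ([T (aFA (eCons b c a) d e)], some (aFA a (cAll b d) (cAll c e)))
  | faK => ([T (aFA a b c)], some (aFA a (cK b) (cK c)))
  | stHit => ([], some (aST a b (cVar a) (cVar b)))
  | stMiss => ([ne c a], some (aST a b (cVar c) (cVar c)))
  | stZero => ([], some (aST a b cZero cZero))
  | stSucc => ([T (aST a b c d)], some (aST a b (cSucc c) (cSucc d)))
  | stAdd => ([T (aST a b c d), T (aST a b e f)], some (aST a b (cAdd c e) (cAdd d f)))
  | stMul => ([T (aST a b c d), T (aST a b e f)], some (aST a b (cMul c e) (cMul d f)))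
  | sfEq => ([T (aST a b c d), T (aST a b e f)], some (aSF a b (cEq c e) (cEq d f)))
  | sfFalsum => ([], some (aSF a b cFalsum cFalsum))
  | sfImp => ([T (aSF a b c d), T (aSF a b e f)], some (aSF a b (cImp c e) (cImp d f)))
  | sfBound => ([], some (aSF a b (cAll a c) (cAll a c)))
  | sfFresh => ([T (aSF a c e e), ne c a], some (aSF a b (cAll d e) (cAll d e)))
  | sfAll => ([T (aSF a b d e), ne c a, ne b c], some (aSF a b (cAll c d) (cAll c e)))
  | sfK => ([T (aSF a b c d)], some (aSF a b (cK c) (cK d)))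
  | trEq => ([T (aTr (cEq a b) c)], some (aEqv (pClos a c) (pClos b c)))
  | trEq' => ([T (aEqv (pClos a c) (pClos b c))], some (aTr (cEq a b) c))
  | trFalsum => ([T (aTr cFalsum a)], none)
  | trMp => ([T (aTr (cImp a b) c), T (aTr a c)], some (aTr b c))
  | trImp => ([T (aTr b c)], some (aTr (cImp a b) c))
  | trImp' => ([F (aTr a c)], some (aTr (cImp a b) c))
  | trAll => ([T (aTr (cAll a b) c)], some (aTr b (eCons a d c)))
  | trHenkin => ([T (aTr b (eCons a (pHen a b c) c))], some (aTr (cAll a b) c))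
  | trAgree => ([T (aAgF a b c), T (aTr (cK a) b)], some (aTr (cK a) c))
  | trAlpha => ([T (aFA eNil a b), T (aTr (cK a) c)], some (aTr (cK b) c))
  | trAlpha' => ([T (aFA eNil a b), T (aTr (cK b) c)], some (aTr (cK a) c))
  | trSubst => ([T (aSF a b c d), T (aTr (cK d) e)],
      some (aTr (cK c) (eCons a (pClos (cVar b) e) e)))
  | trSubst' => ([T (aSF a b c d), T (aTr (cK c) (eCons a (pClos (cVar b) e) e))],
      some (aTr (cK d) e))

/-- The valuation `v` satisfies all instances of all clauses. -/
def Good (v : ℕ → Prop) : Prop :=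
  ∀ (r : Rule) (a b c d e f : ℕ),
    clauseHolds v (r.clause a b c d e f).1 (r.clause a b c d e f).2

/-- The list of all rules. -/
def Rule.list : List Rule := (List.range 61).map Rule.ofNat

theorem Rule.mem_list (r : Rule) : r ∈ Rule.list := by
  cases r <;> decide

/-! ### Decoding -/

theorem unpair_pr (a b : ℕ) : (pr a b).unpair = (a, b) := Nat.unpair_pair a b

theorem lit_nat (i : ℕ) : (lit i : ℕ) = i := rfl

theorem snd_unpair_lt {n : ℕ} (h : n.unpair.1 ≠ 0) : n.unpair.2 < n := by
  have := Nat.add_le_pair n.unpair.1 n.unpair.2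
  rw [Nat.pair_unpair] at this
  omega

/-- Total decoding of terms. -/
def decT (n : ℕ) : LTerm :=
  if n.unpair.1 = 0 then .var n.unpair.2
  else if h2 : n.unpair.1 = 2 then
    have := snd_unpair_lt (n := n) (by omega)
    .succ (decT n.unpair.2)
  else if h3 : n.unpair.1 = 3 then
    have := snd_unpair_lt (n := n) (by omega)
    have := n.unpair.2.unpair_left_le
    have := n.unpair.2.unpair_right_le
    .add (decT n.unpair.2.unpair.1) (decT n.unpair.2.unpair.2)
  else if h4 : n.unpair.1 = 4 then
    have := snd_unpair_lt (n := n) (by omega)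
    have := n.unpair.2.unpair_left_le
    have := n.unpair.2.unpair_right_le
    .mul (decT n.unpair.2.unpair.1) (decT n.unpair.2.unpair.2)
  else .zero
termination_by n
decreasing_by all_goals omega

/-- Total decoding of formulas. -/
def decF (n : ℕ) : LFormula :=
  if n.unpair.1 = 0 then .eq (decT n.unpair.2.unpair.1) (decT n.unpair.2.unpair.2)
  else if h2 : n.unpair.1 = 2 then
    have := snd_unpair_lt (n := n) (by omega)
    have := n.unpair.2.unpair_left_le
    have := n.unpair.2.unpair_right_le
    .imp (decF n.unpair.2.unpair.1) (decF n.unpair.2.unpair.2)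
  else if h3 : n.unpair.1 = 3 then
    have := snd_unpair_lt (n := n) (by omega)
    have := n.unpair.2.unpair_right_le
    .all n.unpair.2.unpair.1 (decF n.unpair.2.unpair.2)
  else if h4 : n.unpair.1 = 4 then
    have := snd_unpair_lt (n := n) (by omega)
    .K (decF n.unpair.2)
  else .falsum
termination_by n
decreasing_by all_goals omega

/-- Total decoding of lists of pairs. -/
def decL (n : ℕ) : List (ℕ × ℕ) :=
  if h : n.unpair.1 = 1 then
    have := snd_unpair_lt (n := n) (by omega)
    have := n.unpair.2.unpair_right_le
    n.unpair.2.unpair.1.unpair :: decL n.unpair.2.unpair.2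
  else []
termination_by n
decreasing_by all_goals omega

theorem decT_var (x : ℕ) : decT (cVar x) = .var x := by
  rw [decT]; simp [unpair_pr, lit_nat]
theorem decT_zero : decT cZero = .zero := by
  rw [decT]; simp [unpair_pr, lit_nat]
theorem decT_succ (t : ℕ) : decT (cSucc t) = .succ (decT t) := by
  rw [decT]; simp [unpair_pr, lit_nat]
theorem decT_add (t u : ℕ) : decT (cAdd t u) = .add (decT t) (decT u) := by
  rw [decT]; simp [unpair_pr, lit_nat]
theorem decT_mul (t u : ℕ) : decT (cMul t u) = .mul (decT t) (decT u) := by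
  rw [decT]; simp [unpair_pr, lit_nat]

theorem decF_eq (t u : ℕ) : decF (cEq t u) = .eq (decT t) (decT u) := by
  rw [decF]; simp [unpair_pr, lit_nat]
theorem decF_falsum : decF cFalsum = .falsum := by
  rw [decF]; simp [unpair_pr, lit_nat]
theorem decF_imp (a b : ℕ) : decF (cImp a b) = .imp (decF a) (decF b) := by
  rw [decF]; simp [unpair_pr, lit_nat]
theorem decF_all (x a : ℕ) : decF (cAll x a) = .all x (decF a) := by
  rw [decF]; simp [unpair_pr, lit_nat]
theorem decF_K (a : ℕ) : decF (cK a) = .K (decF a) := by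
  rw [decF]; simp [unpair_pr, lit_nat]

theorem decL_nil : decL eNil = [] := by
  rw [decL]; simp [unpair_pr, lit_nat]
theorem decL_cons (x y Γ : ℕ) : decL (eCons x y Γ) = (x, y) :: decL Γ := by
  rw [decL]; simp [unpair_pr, lit_nat]

theorem gnum_var (x : ℕ) : (LTerm.var x).gnum = cVar x := rfl
theorem gnum_zero : LTerm.zero.gnum = cZero := rfl
theorem gnum_succ (t : LTerm) : t.succ.gnum = cSucc t.gnum := rfl
theorem gnum_add (t u : LTerm) : (t.add u).gnum = cAdd t.gnum u.gnum := rfl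
theorem gnum_mul (t u : LTerm) : (t.mul u).gnum = cMul t.gnum u.gnum := rfl
theorem gnum_eq (t u : LTerm) : (LFormula.eq t u).gnum = cEq t.gnum u.gnum := rfl
theorem gnum_falsum : LFormula.falsum.gnum = cFalsum := rfl
theorem gnum_imp (φ ψ : LFormula) : (φ.imp ψ).gnum = cImp φ.gnum ψ.gnum := rfl
theorem gnum_all (x : ℕ) (φ : LFormula) : (LFormula.all x φ).gnum = cAll x φ.gnum := rfl
theorem gnum_K (φ : LFormula) : φ.K.gnum = cK φ.gnum := rfl

theorem decT_gnum (t : LTerm) : decT t.gnum = t := by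
  induction t with
  | var n => exact decT_var n
  | zero => exact decT_zero
  | succ t ih => exact (decT_succ _).trans (by rw [ih])
  | add t u iht ihu => exact (decT_add _ _).trans (by rw [iht, ihu])
  | mul t u iht ihu => exact (decT_mul _ _).trans (by rw [iht, ihu])

theorem decF_gnum (φ : LFormula) : decF φ.gnum = φ := by
  induction φ with
  | eq t u => exact (decF_eq _ _).trans (by rw [decT_gnum, decT_gnum])
  | falsum => exact decF_falsum
  | imp a b iha ihb => exact (decF_imp _ _).trans (by rw [iha, ihb])
  | all x a ih => exact (decF_all _ _).trans (by rw [ih])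
  | K a ih => exact (decF_K _).trans (by rw [ih])

/-! ### Substitution lemmas -/

theorem LTerm.subst_eq_self {s : ℕ → LTerm} (t : LTerm) :
    t.subst s = t ↔ ∀ z ∈ t.fv, s z = .var z := by
  induction t <;> simp_all [LTerm.subst, LTerm.fv, or_imp, forall_and]

theorem LFormula.subst_eq_self {φ : LFormula} {s : ℕ → LTerm} :
    φ.subst s = φ ↔ ∀ z ∈ φ.fv, s z = .var z := by
  induction φ generalizing s with
  | all x a ih =>
    simp only [LFormula.subst, LFormula.fv, LFormula.all.injEq, ih, true_and, Finset.mem_erase]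
    refine forall_congr' fun z => ?_
    split_ifs with h <;> simp [h]
  | _ => simp_all [LFormula.subst, LFormula.fv, or_imp, forall_and, LTerm.subst_eq_self]

theorem subst1_var_eq_self {φ : LFormula} {x y : ℕ} :
    subst1 x (.var y) φ = φ ↔ (x ∈ φ.fv → y = x) := by
  rw [subst1, LFormula.subst_eq_self]
  constructor
  · intro h hx
    simpa using h x hx
  · intro h z hz
    split_ifs with hzx
    · subst hzx; rw [h hz]
    · rfl

/-! ### The valuation of a structure -/

namespace LStructure

variable (M : LStructure) (s₀ : ℕ → M.U)

open Classical in
/-- A witness against `∀ x, φ` at `s`, if there is one. -/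
noncomputable def witness (x : ℕ) (φ : LFormula) (s : ℕ → M.U) : M.U :=
  if h : ∃ u, ¬ M.Sat (Function.update s x u) φ then h.choose else s 0

theorem sat_all_of_witness {x : ℕ} {φ : LFormula} {s : ℕ → M.U}
    (h : M.Sat (Function.update s x (M.witness x φ s)) φ) : M.Sat s (.all x φ) := by
  by_contra hn
  have h' : ∃ u, ¬ M.Sat (Function.update s x u) φ := by simpa [Sat] using hn
  rw [witness, dif_pos h'] at h
  exact h'.choose_spec h

/-- The interpretation of a code as a parameter (first component) and as an environment
(second component). -/
noncomputable def codeVal (n : ℕ) : M.U × (ℕ → M.U) :=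
  if h : n.unpair.1 = 0 then (M.zero, s₀) else
  have := snd_unpair_lt h
  have := n.unpair.2.unpair_left_le
  have := n.unpair.2.unpair_right_le
  have := n.unpair.2.unpair.1.unpair_right_le
  have := n.unpair.2.unpair.2.unpair_right_le
  (if n.unpair.1 = 1 then M.zero
   else if n.unpair.1 = 2 then M.succ (codeVal n.unpair.2).1
   else if n.unpair.1 = 3 then
    M.add (codeVal n.unpair.2.unpair.1).1 (codeVal n.unpair.2.unpair.2).1
   else if n.unpair.1 = 4 then
    M.mul (codeVal n.unpair.2.unpair.1).1 (codeVal n.unpair.2.unpair.2).1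
   else if n.unpair.1 = 5 then
    M.witness n.unpair.2.unpair.1 (decF n.unpair.2.unpair.2.unpair.1)
      (codeVal n.unpair.2.unpair.2.unpair.2).2
   else M.evalT (codeVal n.unpair.2.unpair.2).2 (decT n.unpair.2.unpair.1),
  Function.update (codeVal n.unpair.2.unpair.2).2 n.unpair.2.unpair.1.unpair.1
    (codeVal n.unpair.2.unpair.1.unpair.2).1)
termination_by n
decreasing_by all_goals omega

/-- The value of a parameter. -/
noncomputable def parVal (n : ℕ) : M.U := (M.codeVal s₀ n).1

/-- The assignment coded by an environment. -/
noncomputable def envVal (n : ℕ) : ℕ → M.U := (M.codeVal s₀ n).2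

theorem envVal_nil : M.envVal s₀ eNil = s₀ := by
  rw [envVal, codeVal]; simp [unpair_pr, lit_nat]
theorem envVal_cons (x p ρ : ℕ) :
    M.envVal s₀ (eCons x p ρ) = Function.update (M.envVal s₀ ρ) x (M.parVal s₀ p) := by
  rw [envVal, codeVal]; simp [unpair_pr, lit_nat, envVal, parVal]
theorem parVal_zero : M.parVal s₀ pZero = M.zero := by
  rw [parVal, codeVal]; simp [unpair_pr, lit_nat]
theorem parVal_succ (p : ℕ) : M.parVal s₀ (pSucc p) = M.succ (M.parVal s₀ p) := by
  rw [parVal, codeVal]; simp [unpair_pr, lit_nat, parVal]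
theorem parVal_add (p q : ℕ) :
    M.parVal s₀ (pAdd p q) = M.add (M.parVal s₀ p) (M.parVal s₀ q) := by
  rw [parVal, codeVal]; simp [unpair_pr, lit_nat, parVal]
theorem parVal_mul (p q : ℕ) :
    M.parVal s₀ (pMul p q) = M.mul (M.parVal s₀ p) (M.parVal s₀ q) := by
  rw [parVal, codeVal]; simp [unpair_pr, lit_nat, parVal]
theorem parVal_hen (x a ρ : ℕ) :
    M.parVal s₀ (pHen x a ρ) = M.witness x (decF a) (M.envVal s₀ ρ) := by
  rw [parVal, codeVal]; simp [unpair_pr, lit_nat, envVal]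
theorem parVal_clos (t ρ : ℕ) :
    M.parVal s₀ (pClos t ρ) = M.evalT (M.envVal s₀ ρ) (decT t) := by
  rw [parVal, codeVal]; simp [unpair_pr, lit_nat, envVal]

/-- The truth of the atom with constructor number `i` and arguments coded by `d`. -/
def atomVal (i d : ℕ) : Prop :=
  let l := d.unpair.1
  let r := d.unpair.2
  match i with
  | 0 => M.Sat (M.envVal s₀ r) (decF l)
  | 1 => M.parVal s₀ l = M.parVal s₀ r
  | 2 => (decT l).gnum = l ∧
      ∀ z ∈ (decT l).fv, M.envVal s₀ r.unpair.1 z = M.envVal s₀ r.unpair.2 z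
  | 3 => (decF l).gnum = l ∧
      ∀ z ∈ (decF l).fv, M.envVal s₀ r.unpair.1 z = M.envVal s₀ r.unpair.2 z
  | 4 => VarCorr (decL l) r.unpair.1 r.unpair.2
  | 5 => TermAlpha (decL l) (decT r.unpair.1) (decT r.unpair.2)
  | 6 => FormulaAlpha (decL l) (decF r.unpair.1) (decF r.unpair.2)
  | 7 => decT r.unpair.2 = (decT r.unpair.1).subst
      fun z => if z = l.unpair.1 then .var l.unpair.2 else .var z
  | 8 => SubstitutableVar l.unpair.2 l.unpair.1 (decF r.unpair.1) ∧
      decF r.unpair.2 = subst1 l.unpair.1 (.var l.unpair.2) (decF r.unpair.1)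
  | _ => False

/-- The valuation of coded atoms determined by a structure and an assignment. -/
def valuation (n : ℕ) : Prop := M.atomVal s₀ n.unpair.1 n.unpair.2

theorem valuation_tag (i d : ℕ) : M.valuation s₀ (tag i d) ↔ M.atomVal s₀ i d := by
  simp [valuation, unpair_pr, lit_nat]

theorem good_valuation (hM : IsLStructure M) : Good (M.valuation s₀) := by
  obtain ⟨hfv, hα, hsub⟩ := hM
  simp only [subst1] at hsub
  intro r a b c d e f
  cases r <;> simp only [Rule.clause, clauseHolds, Hyp.Sat, valuation_tag, atomVal, unpair_pr,
    parVal_zero, parVal_succ, parVal_add, parVal_mul, parVal_clos, parVal_hen, envVal_cons,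
    decT_var, decT_zero, decT_succ, decT_add, decT_mul, decF_eq, decF_falsum,
    decF_imp, decF_all, decF_K, decL_nil, decL_cons, Sat, evalT, LTerm.subst,
    LTerm.fv, LFormula.fv, VarCorr, TermAlpha, FormulaAlpha,
    SubstitutableVar, gnum_var, gnum_zero, gnum_succ, gnum_add, gnum_mul, gnum_eq, gnum_falsum,
    gnum_imp, gnum_all, gnum_K, subst1, LFormula.subst, true_and, Finset.notMem_empty,
    IsEmpty.forall_iff, implies_true, and_self]
  case trHenkin => exact M.sat_all_of_witness
  case trAgree => exact fun h hs => (hfv _ _ _ h.2).1 hs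
  case trAlpha => exact fun h => (hα _ _ _ h).1
  case trAlpha' => exact fun h => (hα _ _ _ h).2
  case trSubst => exact fun h hs => (hsub _ _ _ _ h.1).1 (by rwa [h.2] at hs)
  case trSubst' => exact fun h hs => by rw [h.2]; exact (hsub _ _ _ _ h.1).2 hs
  case trImp' => exact fun h h' => (h h').elim
  case agAll =>
    rintro ⟨h, h'⟩
    rw [h]
    refine ⟨rfl, fun z hz => ?_⟩
    obtain ⟨hza, hz⟩ := Finset.mem_erase.1 hz
    simpa [hza] using h' z hz
  case sfBound =>
    refine ⟨Or.inl (by simp), ?_⟩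
    congr 1
    exact (LFormula.subst_eq_self.2 fun z _ => by split_ifs <;> simp_all).symm
  case sfFresh =>
    rintro ⟨_, h⟩ hca
    have ha : a ∉ (decF e).fv := fun ha => hca (subst1_var_eq_self.1 h.symm ha)
    refine ⟨Or.inl (by simp [ha]), ?_⟩
    congr 1
    refine (LFormula.subst_eq_self.2 fun z hz => ?_).symm
    have : z ≠ a := fun h => ha (h ▸ hz)
    simp only [this, if_false]
    split_ifs with hzd
    · rw [hzd]
    · rfl
  case sfAll =>
    rintro ⟨h, h'⟩ hca hbc
    refine ⟨Or.inr ⟨hbc, h⟩, ?_⟩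
    rw [h']
    congr 2
    funext z
    split_ifs <;> simp_all
  all_goals clear hfv hα hsub
  all_goals first
    | grind only [Function.update_apply]
    | simp +contextual [or_imp]

end LStructure

/-! ### The structure of a good valuation -/

/-- The code of a list of pairs of bound variables. -/
def encL : List (ℕ × ℕ) → ℕ
  | [] => eNil
  | (x, y) :: Γ => eCons x y (encL Γ)

namespace Good

variable {v : ℕ → Prop} (hv : Good v)
include hv

/-- Parameters up to provable equality. -/
def setoid : Setoid ℕ where
  r p q := v (aEqv p q)
  iseqv :=
    ⟨fun a => hv .eqvRefl a 0 0 0 0 0, fun {a b} => hv .eqvSymm a b 0 0 0 0,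
      fun {a b c} => hv .eqvTrans a b c 0 0 0⟩

/-- The structure of parameters determined by a good valuation. -/
def model : LStructure where
  U := Quotient hv.setoid
  nonempty := ⟨⟦0⟧⟩
  zero := ⟦pZero⟧
  succ := Quotient.map pSucc fun a b => hv .eqvSucc a b 0 0 0 0
  add := Quotient.map₂ pAdd fun a b h c d => hv .eqvAdd a b c d 0 0 h
  mul := Quotient.map₂ pMul fun a b h c d => hv .eqvMul a b c d 0 0 h
  satK s φ := ∃ ρ, (∀ z ∈ φ.fv, (⟦pClos (cVar z) ρ⟧ : Quotient hv.setoid) = s z) ∧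
    v (aTr (cK φ.gnum) ρ)

/-- The element of the structure named by a parameter. -/
def param (p : ℕ) : hv.model.U := (⟦p⟧ : Quotient hv.setoid)

/-- The assignment coded by an environment. -/
def assign (ρ : ℕ) (z : ℕ) : hv.model.U := hv.param (pClos (cVar z) ρ)

theorem exists_param (u : hv.model.U) : ∃ p, hv.param p = u := Quotient.exists_rep u

theorem param_eq {p q : ℕ} : hv.param p = hv.param q ↔ v (aEqv p q) := Quotient.eq (r := hv.setoid)

theorem assign_cons (x p ρ : ℕ) :
    hv.assign (eCons x p ρ) = Function.update (hv.assign ρ) x (hv.param p) := by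
  funext z
  by_cases hz : z = x
  · subst hz
    rw [Function.update_self]
    exact hv.param_eq.2 (hv .closHit z p ρ 0 0 0)
  · rw [Function.update_of_ne hz]
    exact hv.param_eq.2 (hv .closMiss x p ρ z 0 0 hz)

theorem evalT_assign (ρ : ℕ) (t : LTerm) :
    hv.model.evalT (hv.assign ρ) t = hv.param (pClos t.gnum ρ) := by
  induction t with
  | var z => rfl
  | zero => exact (hv.param_eq.2 (hv .closZero ρ 0 0 0 0 0)).symm
  | succ t ih =>
    rw [LStructure.evalT, ih]
    exact (hv.param_eq.2 (hv .closSucc t.gnum ρ 0 0 0 0)).symm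
  | add t u iht ihu =>
    rw [LStructure.evalT, iht, ihu]
    exact (hv.param_eq.2 (hv .closAdd t.gnum u.gnum ρ 0 0 0)).symm
  | mul t u iht ihu =>
    rw [LStructure.evalT, iht, ihu]
    exact (hv.param_eq.2 (hv .closMul t.gnum u.gnum ρ 0 0 0)).symm

theorem agT {ρ σ : ℕ} {t : LTerm} (h : ∀ z ∈ t.fv, hv.assign ρ z = hv.assign σ z) :
    v (aAgT t.gnum ρ σ) := by
  induction t with
  | var z => exact hv .agVar z ρ σ 0 0 0 (hv.param_eq.1 (h z (by simp [LTerm.fv])))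
  | zero => exact hv .agZero ρ σ 0 0 0 0
  | succ t ih => exact hv .agSucc t.gnum ρ σ 0 0 0 (ih h)
  | add t u iht ihu =>
    exact hv .agAdd t.gnum u.gnum ρ σ 0 0 (iht fun z hz => h z (Finset.mem_union_left _ hz))
      (ihu fun z hz => h z (Finset.mem_union_right _ hz))
  | mul t u iht ihu =>
    exact hv .agMul t.gnum u.gnum ρ σ 0 0 (iht fun z hz => h z (Finset.mem_union_left _ hz))
      (ihu fun z hz => h z (Finset.mem_union_right _ hz))

theorem agF {ρ σ : ℕ} {φ : LFormula} (h : ∀ z ∈ φ.fv, hv.assign ρ z = hv.assign σ z) :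
    v (aAgF φ.gnum ρ σ) := by
  induction φ generalizing ρ σ with
  | eq t u =>
    exact hv .agEq t.gnum u.gnum ρ σ 0 0 (hv.agT fun z hz => h z (Finset.mem_union_left _ hz))
      (hv.agT fun z hz => h z (Finset.mem_union_right _ hz))
  | falsum => exact hv .agFalsum ρ σ 0 0 0 0
  | imp a b iha ihb =>
    exact hv .agImp a.gnum b.gnum ρ σ 0 0 (iha fun z hz => h z (Finset.mem_union_left _ hz))
      (ihb fun z hz => h z (Finset.mem_union_right _ hz))
  | all x a ih =>
    refine hv .agAll x a.gnum ρ σ 0 0 (ih fun z hz => ?_)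
    rw [hv.assign_cons, hv.assign_cons]
    by_cases hzx : z = x
    · subst hzx; simp
    · rw [Function.update_of_ne hzx, Function.update_of_ne hzx]
      exact h z (Finset.mem_erase.2 ⟨hzx, hz⟩)
  | K a ih => exact hv .agK a.gnum ρ σ 0 0 0 (ih h)

theorem exists_assign (s : ℕ → hv.model.U) (F : Finset ℕ) :
    ∃ ρ, ∀ z ∈ F, hv.assign ρ z = s z := by
  induction F using Finset.induction_on with
  | empty => exact ⟨0, by simp⟩
  | insert x F _ ih =>
    obtain ⟨ρ, hρ⟩ := ih
    obtain ⟨p, hp⟩ := hv.exists_param (s x)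
    refine ⟨eCons x p ρ, fun z hz => ?_⟩
    rw [hv.assign_cons]
    by_cases hzx : z = x
    · subst hzx; simpa using hp
    · rw [Function.update_of_ne hzx]
      exact hρ z ((Finset.mem_insert.1 hz).resolve_left hzx)

theorem satK_iff {s : ℕ → hv.model.U} {ρ : ℕ} {φ : LFormula}
    (h : ∀ z ∈ φ.fv, hv.assign ρ z = s z) :
    hv.model.satK s φ ↔ v (aTr (cK φ.gnum) ρ) := by
  refine ⟨?_, fun h' => ⟨ρ, h, h'⟩⟩
  rintro ⟨σ, hσ, h'⟩
  exact hv .trAgree φ.gnum σ ρ 0 0 0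
    (hv.agF fun z hz => (hσ z hz).trans (h z hz).symm) h'

theorem sat_iff {s : ℕ → hv.model.U} {ρ : ℕ} {φ : LFormula}
    (h : ∀ z ∈ φ.fv, hv.assign ρ z = s z) :
    hv.model.Sat s φ ↔ v (aTr φ.gnum ρ) := by
  induction φ generalizing s ρ with
  | eq t u =>
    have key : ∀ t : LTerm, (∀ z ∈ t.fv, hv.assign ρ z = s z) →
        hv.model.evalT s t = hv.model.evalT (hv.assign ρ) t := by
      intro t ht
      induction t with
      | var z => exact (ht z (by simp [LTerm.fv])).symm
      | zero => rfl
      | succ t ih => rw [LStructure.evalT, LStructure.evalT, ih ht]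
      | add t u iht ihu =>
        rw [LStructure.evalT, LStructure.evalT, iht fun z hz => ht z (Finset.mem_union_left _ hz),
          ihu fun z hz => ht z (Finset.mem_union_right _ hz)]
      | mul t u iht ihu =>
        rw [LStructure.evalT, LStructure.evalT, iht fun z hz => ht z (Finset.mem_union_left _ hz),
          ihu fun z hz => ht z (Finset.mem_union_right _ hz)]
    rw [LStructure.Sat, key t fun z hz => h z (Finset.mem_union_left _ hz),
      key u fun z hz => h z (Finset.mem_union_right _ hz), evalT_assign, evalT_assign]
    exact hv.param_eq.trans
      ⟨hv .trEq' t.gnum u.gnum ρ 0 0 0, hv .trEq t.gnum u.gnum ρ 0 0 0⟩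
  | falsum => exact ⟨False.elim, hv .trFalsum ρ 0 0 0 0 0⟩
  | imp a b iha ihb =>
    rw [LStructure.Sat, iha fun z hz => h z (Finset.mem_union_left _ hz),
      ihb fun z hz => h z (Finset.mem_union_right _ hz)]
    refine ⟨fun hab => ?_, hv .trMp a.gnum b.gnum ρ 0 0 0⟩
    by_cases ha : v (aTr a.gnum ρ)
    · exact hv .trImp a.gnum b.gnum ρ 0 0 0 (hab ha)
    · exact hv .trImp' a.gnum b.gnum ρ 0 0 0 ha
  | all x a ih =>
    have key : ∀ p, hv.model.Sat (Function.update s x (hv.param p)) a ↔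
        v (aTr a.gnum (eCons x p ρ)) := by
      refine fun p => ih fun z hz => ?_
      rw [hv.assign_cons]
      by_cases hzx : z = x
      · subst hzx; simp
      · rw [Function.update_of_ne hzx, Function.update_of_ne hzx]
        exact h z (Finset.mem_erase.2 ⟨hzx, hz⟩)
    refine ⟨fun hs => hv .trHenkin x a.gnum ρ 0 0 0 ((key _).1 (hs _)), fun hs u => ?_⟩
    obtain ⟨p, rfl⟩ := hv.exists_param u
    exact (key p).2 (hv .trAll x a.gnum ρ p 0 0 hs)
  | K a => exact hv.satK_iff h

/-! #### Alphabetic variants -/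

theorem varCorr {Γ : List (ℕ × ℕ)} {x y : ℕ} (h : VarCorr Γ x y) : v (aVC (encL Γ) x y) := by
  induction Γ with
  | nil => cases h; exact hv .vcNil x 0 0 0 0 0
  | cons p Γ ih =>
    rcases h with ⟨rfl, rfl⟩ | ⟨h₁, h₂, h⟩
    · exact hv .vcHit _ _ (encL Γ) 0 0 0
    · exact hv .vcMiss p.1 p.2 (encL Γ) x y 0 h₁ h₂ (ih h)

theorem termAlpha {Γ : List (ℕ × ℕ)} {t u : LTerm} (h : TermAlpha Γ t u) :
    v (aTA (encL Γ) t.gnum u.gnum) := by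
  induction t generalizing u with
  | var x =>
    cases u <;> try exact h.elim
    exact hv .taVar (encL Γ) x _ 0 0 0 (hv.varCorr h)
  | zero =>
    cases u <;> try exact h.elim
    exact hv .taZero (encL Γ) 0 0 0 0 0
  | succ t ih =>
    cases u <;> try exact h.elim
    exact hv .taSucc (encL Γ) t.gnum _ 0 0 0 (ih h)
  | add t₁ t₂ ih₁ ih₂ =>
    cases u <;> try exact h.elim
    exact hv .taAdd (encL Γ) t₁.gnum _ t₂.gnum _ 0 (ih₁ h.1) (ih₂ h.2)
  | mul t₁ t₂ ih₁ ih₂ =>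
    cases u <;> try exact h.elim
    exact hv .taMul (encL Γ) t₁.gnum _ t₂.gnum _ 0 (ih₁ h.1) (ih₂ h.2)

theorem formulaAlpha {Γ : List (ℕ × ℕ)} {φ ψ : LFormula} (h : FormulaAlpha Γ φ ψ) :
    v (aFA (encL Γ) φ.gnum ψ.gnum) := by
  induction φ generalizing Γ ψ with
  | eq t₁ t₂ =>
    cases ψ <;> try exact h.elim
    exact hv .faEq (encL Γ) t₁.gnum _ t₂.gnum _ 0 (hv.termAlpha h.1) (hv.termAlpha h.2)
  | falsum =>
    cases ψ <;> try exact h.elim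
    exact hv .faFalsum (encL Γ) 0 0 0 0 0
  | imp a b iha ihb =>
    cases ψ <;> try exact h.elim
    exact hv .faImp (encL Γ) a.gnum _ b.gnum _ 0 (iha h.1) (ihb h.2)
  | all x a ih =>
    cases ψ <;> try exact h.elim
    exact hv .faAll (encL Γ) x _ a.gnum _ 0 (ih (Γ := (x, _) :: Γ) h)
  | K a ih =>
    cases ψ <;> try exact h.elim
    exact hv .faK (encL Γ) a.gnum _ 0 0 0 (ih h)

/-! #### Substitution of variables -/

theorem substT (x y : ℕ) (t : LTerm) :
    v (aST x y t.gnum (t.subst fun z => if z = x then .var y else .var z).gnum) := by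
  induction t with
  | var z =>
    by_cases hz : z = x
    · subst hz
      rw [LTerm.subst, if_pos rfl]
      exact hv .stHit z y 0 0 0 0
    · rw [LTerm.subst, if_neg hz]
      exact hv .stMiss x y z 0 0 0 hz
  | zero => exact hv .stZero x y 0 0 0 0
  | succ t ih => exact hv .stSucc x y t.gnum _ 0 0 ih
  | add t u iht ihu => exact hv .stAdd x y t.gnum _ u.gnum _ iht ihu
  | mul t u iht ihu => exact hv .stMul x y t.gnum _ u.gnum _ iht ihu

theorem substF_self {x : ℕ} {φ : LFormula} (hx : x ∉ φ.fv) :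
    ∃ N, ∀ y ≥ N, v (aSF x y φ.gnum φ.gnum) := by
  have term : ∀ t : LTerm, x ∉ t.fv → ∀ y, v (aST x y t.gnum t.gnum) := by
    intro t ht y
    have := hv.substT x y t
    rwa [t.subst_eq_self.2 fun z hz => if_neg fun h : z = x => ht (h ▸ hz)] at this
  induction φ with
  | eq t u =>
    rw [LFormula.fv, Finset.notMem_union] at hx
    exact ⟨0, fun y _ => hv .sfEq x y t.gnum t.gnum u.gnum u.gnum (term t hx.1 y)
      (term u hx.2 y)⟩
  | falsum => exact ⟨0, fun y _ => hv .sfFalsum x y 0 0 0 0⟩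
  | imp a b iha ihb =>
    rw [LFormula.fv, Finset.notMem_union] at hx
    obtain ⟨N, hN⟩ := iha hx.1
    obtain ⟨N', hN'⟩ := ihb hx.2
    exact ⟨max N N', fun y hy => hv .sfImp x y a.gnum a.gnum b.gnum b.gnum
      (hN y (le_of_max_le_left hy)) (hN' y (le_of_max_le_right hy))⟩
  | all z a ih =>
    refine ⟨0, fun y _ => ?_⟩
    by_cases hz : z = x
    · subst hz
      exact hv .sfBound z y a.gnum 0 0 0
    · have ha : x ∉ a.fv := fun h => hx (Finset.mem_erase.2 ⟨fun h => hz h.symm, h⟩)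
      obtain ⟨N, hN⟩ := ih ha
      exact hv .sfFresh x y (max N (x + 1)) z a.gnum 0 (hN _ (le_max_left _ _))
        (Nat.ne_of_gt (le_max_right N (x + 1)))
  | K a ih =>
    obtain ⟨N, hN⟩ := ih hx
    exact ⟨N, fun y hy => hv .sfK x y a.gnum a.gnum 0 0 (hN y hy)⟩

theorem substF {x y : ℕ} {φ : LFormula} (h : SubstitutableVar y x φ) :
    v (aSF x y φ.gnum (subst1 x (.var y) φ).gnum) := by
  induction φ with
  | eq t u => exact hv .sfEq x y t.gnum _ u.gnum _ (hv.substT x y t) (hv.substT x y u)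
  | falsum => exact hv .sfFalsum x y 0 0 0 0
  | imp a b iha ihb => exact hv .sfImp x y a.gnum _ b.gnum _ (iha h.1) (ihb h.2)
  | all z a ih =>
    by_cases hz : z = x
    · subst hz
      rw [subst1_var_eq_self.2 fun h => by simp [LFormula.fv] at h]
      exact hv .sfBound z y a.gnum 0 0 0
    rcases h with h | ⟨hyz, h⟩
    · rw [subst1_var_eq_self.2 fun h' => (h h').elim]
      have ha : x ∉ a.fv := fun h' => h (Finset.mem_erase.2 ⟨fun h => hz h.symm, h'⟩)
      obtain ⟨N, hN⟩ := hv.substF_self ha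
      exact hv .sfFresh x y (max N (x + 1)) z a.gnum 0 (hN _ (le_max_left _ _))
        (Nat.ne_of_gt (le_max_right N (x + 1)))
    · have : subst1 x (.var y) (.all z a) = .all z (subst1 x (.var y) a) := by
        rw [subst1, LFormula.subst, subst1]
        congr 2
        funext w
        by_cases hw : w = z
        · simp [hw, hz]
        · simp [hw]
      rw [this]
      exact hv .sfAll x y z a.gnum _ 0 (ih h) hz hyz
  | K a ih => exact hv .sfK x y a.gnum _ 0 0 (ih h)

theorem isLStructure_model : IsLStructure hv.model := by
  refine ⟨fun φ s t hst => ?_, fun φ ψ s h => ?_, fun φ x y s h => ?_⟩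
  · obtain ⟨ρ, hρ⟩ := hv.exists_assign s φ.fv
    rw [hv.satK_iff hρ, hv.satK_iff fun z hz => (hρ z hz).trans (hst z hz)]
  · obtain ⟨ρ, hρ⟩ := hv.exists_assign s (φ.fv ∪ ψ.fv)
    rw [hv.satK_iff fun z hz => hρ z (Finset.mem_union_left _ hz),
      hv.satK_iff fun z hz => hρ z (Finset.mem_union_right _ hz)]
    have := hv.formulaAlpha h
    exact ⟨hv .trAlpha φ.gnum ψ.gnum ρ 0 0 0 this, hv .trAlpha' φ.gnum ψ.gnum ρ 0 0 0 this⟩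
  · obtain ⟨ρ, hρ⟩ := hv.exists_assign s ((subst1 x (.var y) φ).fv ∪ insert y φ.fv)
    rw [hv.satK_iff fun z hz => hρ z (Finset.mem_union_left _ hz),
      hv.satK_iff (ρ := eCons x (pClos (cVar y) ρ) ρ) fun z hz => ?_]
    · have := hv.substF h
      exact ⟨hv .trSubst x y φ.gnum _ ρ 0 this, hv .trSubst' x y φ.gnum _ ρ 0 this⟩
    · have hy : hv.param (pClos (cVar y) ρ) = s y := hρ y (by simp)
      rw [hv.assign_cons, hy]
      by_cases hzx : z = x
      · subst hzx
        rw [Function.update_self, Function.update_self]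
      · rw [Function.update_of_ne hzx, Function.update_of_ne hzx]
        exact hρ z (by simp [hz])

end Good

/-! ### Compactness -/

/-- A property of valuations approximated by an increasing sequence of properties, the `M`-th
of which depends on the first `M` atoms only, holds of all valuations iff, for some `M`, the
`M`-th approximation holds of all valuations given by the binary digits of a number below
`2 ^ M`. -/
theorem exists_uniform_bound {B : ℕ → (ℕ → Prop) → Prop}
    (mono : ∀ {M N v}, M ≤ N → B M v → B N v)
    (loc : ∀ {M} {v w : ℕ → Prop}, (∀ a < M, v a ↔ w a) → B M v → B M w) :
    (∀ v, ∃ M, B M v) ↔ ∃ M, ∀ b < 2 ^ M, B M fun a => b.testBit a = true := by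
  constructor
  · intro h
    have isOpen (M : ℕ) : IsOpen {u : ℕ → Bool | B M fun a => u a = true} := by
      have : {u : ℕ → Bool | B M fun a => u a = true} =
          (fun (u : ℕ → Bool) (i : Fin M) => u i) ⁻¹'
            {w | ∃ u : ℕ → Bool, (∀ i : Fin M, u i = w i) ∧ B M fun a => u a = true} := by
        ext u
        refine ⟨fun hu => ⟨u, fun _ => rfl, hu⟩, ?_⟩
        rintro ⟨u', h, hu'⟩
        exact loc (fun a ha => by rw [h ⟨a, ha⟩]) hu'
      rw [this]
      exact (isOpen_discrete _).preimage (by fun_prop)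
    obtain ⟨M, hM⟩ := (isCompact_univ (X := ℕ → Bool)).elim_directed_cover _ isOpen
      (fun u _ => Set.mem_iUnion.2 (h fun a => u a = true))
      (directed_of_isDirected_le fun M N hMN u hu => mono hMN hu)
    exact ⟨M, fun b _ => hM (Set.mem_univ fun a => b.testBit a)⟩
  · rintro ⟨M, hM⟩ v
    classical
    refine ⟨M, loc (fun a ha => ?_)
      (hM (Nat.ofBits fun i : Fin M => decide (v i)) (Nat.ofBits_lt_two_pow _))⟩
    rw [Nat.testBit_ofBits_lt _ _ ha]
    simp

/-- `refuted v M hs c`: the clause with hypotheses `hs` and conclusion `c` fails under `v`, and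
only concerns atoms below `M`. -/
def refuted (v : ℕ → Prop) (M : ℕ) : List (Hyp ℕ) → Option ℕ → Prop
  | [], none => True
  | [], some p => p < M ∧ ¬ v p
  | .T p :: hs, c => (p < M ∧ v p) ∧ refuted v M hs c
  | .F p :: hs, c => (p < M ∧ ¬ v p) ∧ refuted v M hs c
  | .ne p q :: hs, c => p ≠ q ∧ refuted v M hs c

section Refuted

variable {v w : ℕ → Prop} {M N : ℕ} {hs : List (Hyp ℕ)} {c : Option ℕ}

theorem refuted.mono (hMN : M ≤ N) (h : refuted v M hs c) : refuted v N hs c := by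
  induction hs with
  | nil =>
    cases c with
    | none => trivial
    | some p => exact ⟨h.1.trans_le hMN, h.2⟩
  | cons p hs ih =>
    cases p with
    | T p => exact ⟨⟨h.1.1.trans_le hMN, h.1.2⟩, ih h.2⟩
    | F p => exact ⟨⟨h.1.1.trans_le hMN, h.1.2⟩, ih h.2⟩
    | ne p q => exact ⟨h.1, ih h.2⟩

theorem refuted.congr (hvw : ∀ a < M, v a ↔ w a) (h : refuted v M hs c) : refuted w M hs c := by
  induction hs with
  | nil =>
    cases c with
    | none => trivial
    | some p => exact ⟨h.1, fun hw => h.2 ((hvw p h.1).2 hw)⟩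
  | cons p hs ih =>
    cases p with
    | T p => exact ⟨⟨h.1.1, (hvw p h.1.1).1 h.1.2⟩, ih h.2⟩
    | F p => exact ⟨⟨h.1.1, fun hw => h.1.2 ((hvw p h.1.1).2 hw)⟩, ih h.2⟩
    | ne p q => exact ⟨h.1, ih h.2⟩

theorem exists_refuted : (∃ M, refuted v M hs c) ↔ ¬ clauseHolds v hs c := by
  induction hs with
  | nil =>
    cases c with
    | none => simp [refuted, clauseHolds]
    | some p => exact ⟨fun ⟨M, _, h⟩ => h, fun h => ⟨p + 1, p.lt_succ_self, h⟩⟩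
  | cons p hs ih =>
    rw [clauseHolds, Classical.not_imp, ← ih]
    cases p with
    | T p =>
      exact ⟨fun ⟨M, h, h'⟩ => ⟨h.2, M, h'⟩, fun ⟨h, M, h'⟩ => ⟨max (p + 1) M,
        ⟨le_max_left (p + 1) M, h⟩, h'.mono (le_max_right _ _)⟩⟩
    | F p =>
      exact ⟨fun ⟨M, h, h'⟩ => ⟨h.2, M, h'⟩, fun ⟨h, M, h'⟩ => ⟨max (p + 1) M,
        ⟨le_max_left (p + 1) M, h⟩, h'.mono (le_max_right _ _)⟩⟩
    | ne p q => exact ⟨fun ⟨M, h, h'⟩ => ⟨h, M, h'⟩, fun ⟨h, M, h'⟩ => ⟨M, h, h'⟩⟩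

end Refuted

/-! ### Consequence as refutability -/

/-- The clause stating that the formula coded by `t` is true if `k` codes a formula. -/
def sentenceClause {α : Type} [PairAlg α] (k t : α) : List (Hyp α) × Option α :=
  ([.T (aAgF k eNil eNil)], some (aTr t eNil))

/-- The clause stating that the formula coded by `k`, if there is one, is false. -/
def goalClause {α : Type} [PairAlg α] (k : α) : List (Hyp α) × Option α :=
  ([.T (aAgF k eNil eNil), .T (aTr k eNil)], none)

/-- The iterated components of a tuple. -/
def comp : ℕ → ℕ → ℕ
  | 0, n => n.unpair.1
  | j + 1, n => comp j n.unpair.2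

open Nat.Partrec (Code) in
/-- Some clause with index below `M` is refuted by `v`, for the axioms with r.e. index `e` and
the goal coded by `k`. -/
def Refutes (e k M : ℕ) (v : ℕ → Prop) : Prop :=
  ∃ i < M,
    (∃ r ∈ Rule.list,
      let c := r.clause (comp 0 i) (comp 1 i) (comp 2 i) (comp 3 i) (comp 4 i) (comp 5 i)
      refuted v M c.1 c.2) ∨
    refuted v M (goalClause k).1 (goalClause k).2 ∨
    ((Code.evaln M (Denumerable.ofNat Code e) i).isSome = true ∧
      refuted v M (sentenceClause k i).1 (sentenceClause k i).2)

/-- `v` satisfies all clauses for the axioms with r.e. index `e` and the goal coded by `k`. -/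
def Countermodel (e k : ℕ) (v : ℕ → Prop) : Prop :=
  Good v ∧ (v (aAgF k eNil eNil) → ¬ v (aTr k eNil)) ∧
    ∀ i ∈ W e, v (aAgF k eNil eNil) → v (aTr i eNil)

theorem evaln_isSome_mono {M N : ℕ} {c : Nat.Partrec.Code} {i : ℕ} (hMN : M ≤ N)
    (h : (c.evaln M i).isSome = true) : (c.evaln N i).isSome = true := by
  obtain ⟨x, hx⟩ := Option.isSome_iff_exists.1 h
  exact Option.isSome_iff_exists.2 ⟨x, Nat.Partrec.Code.evaln_mono hMN hx⟩

theorem Refutes.mono {e k M N : ℕ} {v : ℕ → Prop} (hMN : M ≤ N) (h : Refutes e k M v) :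
    Refutes e k N v := by
  obtain ⟨i, hi, h⟩ := h
  refine ⟨i, hi.trans_le hMN, ?_⟩
  rcases h with ⟨r, hr, h⟩ | h | ⟨h, h'⟩
  · exact Or.inl ⟨r, hr, h.mono hMN⟩
  · exact Or.inr (Or.inl (h.mono hMN))
  · exact Or.inr (Or.inr ⟨evaln_isSome_mono hMN h, h'.mono hMN⟩)

theorem Refutes.congr {e k M : ℕ} {v w : ℕ → Prop} (hvw : ∀ a < M, v a ↔ w a)
    (h : Refutes e k M v) : Refutes e k M w := by
  obtain ⟨i, hi, h⟩ := h
  refine ⟨i, hi, ?_⟩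
  rcases h with ⟨r, hr, h⟩ | h | ⟨h, h'⟩
  · exact Or.inl ⟨r, hr, h.congr hvw⟩
  · exact Or.inr (Or.inl (h.congr hvw))
  · exact Or.inr (Or.inr ⟨h, h'.congr hvw⟩)

theorem mem_W_iff {e i : ℕ} : i ∈ W e ↔
    ∃ M, ((Denumerable.ofNat Nat.Partrec.Code e).evaln M i).isSome = true := by
  simp only [W, Set.mem_ofPred_eq, Part.dom_iff_mem, Nat.Partrec.Code.evaln_complete,
    Option.isSome_iff_exists, Option.mem_def]
  exact exists_comm

theorem exists_refutes_iff {e k : ℕ} {v : ℕ → Prop} :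
    (∃ M, Refutes e k M v) ↔ ¬ Countermodel e k v := by
  constructor
  · rintro ⟨M, i, _, ⟨r, _, h⟩ | h | ⟨h, h'⟩⟩ ⟨hv, hk, hW⟩
    · exact exists_refuted.1 ⟨M, h⟩ (hv r _ _ _ _ _ _)
    · exact exists_refuted.1 ⟨M, h⟩ hk
    · exact exists_refuted.1 ⟨M, h'⟩ (hW i (mem_W_iff.2 ⟨M, h⟩))
  · intro h
    by_contra hn
    refine h ⟨fun r a b c d e' f => ?_, ?_, fun i hi => ?_⟩
    · by_contra hc
      obtain ⟨M, hM⟩ := exists_refuted.2 hc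
      set i := Nat.pair a (Nat.pair b (Nat.pair c (Nat.pair d (Nat.pair e' (Nat.pair f 0)))))
        with hi
      refine hn ⟨max M (i + 1), i, lt_of_lt_of_le i.lt_succ_self (le_max_right _ _),
        Or.inl ⟨r, r.mem_list, ?_⟩⟩
      simpa [hi, comp] using hM.mono (le_max_left M (i + 1))
    · by_contra hc
      obtain ⟨M, hM⟩ := exists_refuted (hs := (goalClause k).1) (c := (goalClause k).2).2 hc
      exact hn ⟨max M 1, 0, lt_of_lt_of_le Nat.one_pos (le_max_right _ _),
        Or.inr (Or.inl (hM.mono (le_max_left _ _)))⟩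
    · by_contra hc
      obtain ⟨M, hM⟩ :=
        exists_refuted (hs := (sentenceClause k i).1) (c := (sentenceClause k i).2).2 hc
      obtain ⟨N, hN⟩ := mem_W_iff.1 hi
      exact hn ⟨max (max M N) (i + 1), i, lt_of_lt_of_le i.lt_succ_self (le_max_right _ _),
        Or.inr (Or.inr ⟨evaln_isSome_mono ((le_max_right _ _).trans (le_max_left _ _)) hN,
          hM.mono ((le_max_left _ _).trans (le_max_left _ _))⟩)⟩

open LStructure in
theorem no_countermodel_iff {e k : ℕ} {T : Set LFormula} (hT : ∀ φ ∈ T, φ.fv = ∅)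
    (he : W e = {k : ℕ | ∃ φ ∈ T, k = φ.gnum}) :
    (∀ v, ¬ Countermodel e k v) ↔ ∃ φ : LFormula, Consequence T φ ∧ k = φ.gnum := by
  constructor
  · intro h
    by_cases hk : (decF k).gnum = k
    · refine ⟨decF k, fun M hM hMT s => ?_, hk.symm⟩
      by_contra hn
      refine h _ ⟨M.good_valuation s hM, fun _ h' => hn ?_, fun i hi _ => ?_⟩
      · simpa only [valuation_tag, atomVal, unpair_pr, envVal_nil] using h'
      · rw [he] at hi
        obtain ⟨φ, hφ, rfl⟩ := hi
        simpa only [valuation_tag, atomVal, unpair_pr, envVal_nil, decF_gnum] using hMT φ hφ s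
    · let M : LStructure := ⟨Unit, ⟨()⟩, (), id, fun _ => id, fun _ => id, fun _ _ => True⟩
      have hM : IsLStructure M :=
        ⟨fun _ _ _ _ => Iff.rfl, fun _ _ _ _ => Iff.rfl, fun _ _ _ _ _ => Iff.rfl⟩
      have hg : ¬ M.valuation (fun _ => ()) (aAgF k eNil eNil) := by
        simp only [valuation_tag, atomVal, unpair_pr]
        exact fun h => hk h.1
      exact (h _ ⟨M.good_valuation (fun _ => ()) hM, fun h' => (hg h').elim,
        fun _ _ h' => (hg h').elim⟩).elim
  · rintro ⟨φ, hφ, rfl⟩ v ⟨hv, hk, hW⟩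
    have guard : v (aAgF φ.gnum eNil eNil) := hv.agF fun _ _ => rfl
    refine hk guard ((hv.sat_iff fun _ _ => rfl).1
      (hφ hv.model hv.isLStructure_model (fun σ hσ s => ?_) (hv.assign eNil)))
    refine (hv.sat_iff (ρ := eNil) fun z hz => ?_).2 (hW σ.gnum ?_ guard)
    · rw [hT σ hσ] at hz
      exact absurd hz (Finset.notMem_empty z)
    · rw [he]
      exact ⟨σ, hσ, rfl⟩

theorem consequence_iff {e k : ℕ} {T : Set LFormula} (hT : ∀ φ ∈ T, φ.fv = ∅)
    (he : W e = {k : ℕ | ∃ φ ∈ T, k = φ.gnum}) :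
    (∃ φ : LFormula, Consequence T φ ∧ k = φ.gnum) ↔
      ∃ M, ∀ b < 2 ^ M, Refutes e k M fun a => b.testBit a = true := by
  rw [← no_countermodel_iff hT he, ← exists_uniform_bound (B := Refutes e k) Refutes.mono Refutes.congr]
  exact forall_congr' fun v => exists_refutes_iff.symm

/-! ### Computability -/

/-- Primitive recursive functions form a pairing algebra. -/
instance : PairAlg {f : ℕ → ℕ // Primrec f} where
  pr f g := ⟨fun n => Nat.pair (f.1 n) (g.1 n), Primrec₂.natPair.comp f.2 g.2⟩
  lit i := ⟨fun _ => i, Primrec.const i⟩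

/-- Evaluation of a hypothesis depending on a parameter. -/
def Hyp.eval (n : ℕ) : Hyp {f : ℕ → ℕ // Primrec f} → Hyp ℕ
  | T f => T (f.1 n)
  | F f => F (f.1 n)
  | ne f g => ne (f.1 n) (g.1 n)

theorem Rule.clause_eval (r : Rule) (a b c d e f : {f : ℕ → ℕ // Primrec f}) (n : ℕ) :
    r.clause (a.1 n) (b.1 n) (c.1 n) (d.1 n) (e.1 n) (f.1 n) =
      ((r.clause a b c d e f).1.map (Hyp.eval n),
        (r.clause a b c d e f).2.map fun f => f.1 n) := by
  cases r <;> rfl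

theorem primrec_two_pow : Primrec fun n : ℕ => 2 ^ n :=
  (Primrec.nat_rec₁ 1 (Primrec.nat_mul.comp (Primrec.const 2) Primrec.snd).to₂).of_eq fun n => by
    induction n with
    | zero => rfl
    | succ n ih => rw [pow_succ', ← ih]

theorem primrecRel_testBit : PrimrecRel fun b a : ℕ => b.testBit a = true :=
  (Primrec.eq.comp (Primrec.nat_mod.comp (Primrec.nat_div.comp Primrec.fst
    (primrec_two_pow.comp Primrec.snd)) (Primrec.const 2)) (Primrec.const 1)).of_eq
    fun x => by simp [Nat.testBit_eq_decide_div_mod_eq]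

theorem primrec_refuted (hs : List (Hyp {f : ℕ → ℕ // Primrec f}))
    (c : Option {f : ℕ → ℕ // Primrec f}) :
    PrimrecPred fun x : (ℕ × ℕ) × ℕ => refuted (fun a => x.1.2.testBit a = true) x.1.1
      (hs.map (Hyp.eval x.2)) (c.map fun f => f.1 x.2) := by
  have bound : ∀ f : {f : ℕ → ℕ // Primrec f},
      PrimrecPred fun x : (ℕ × ℕ) × ℕ => f.1 x.2 < x.1.1 := fun f =>
    Primrec.nat_lt.comp (f.2.comp Primrec.snd) (Primrec.fst.comp Primrec.fst)
  have bit : ∀ f : {f : ℕ → ℕ // Primrec f},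
      PrimrecPred fun x : (ℕ × ℕ) × ℕ => x.1.2.testBit (f.1 x.2) = true := fun f =>
    primrecRel_testBit.comp (Primrec.snd.comp Primrec.fst) (f.2.comp Primrec.snd)
  induction hs with
  | nil =>
    cases c with
    | none => exact (Primrec.eq.comp (Primrec.const 0) (Primrec.const 0)).of_eq (by simp [refuted])
    | some f => exact (bound f).and (bit f).not
  | cons h hs ih =>
    cases h with
    | T f => exact ((bound f).and (bit f)).and ih
    | F f => exact ((bound f).and (bit f).not).and ih
    | ne f g =>
      exact (Primrec.eq.comp (f.2.comp Primrec.snd) (g.2.comp Primrec.snd)).not.and ih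

theorem primrec_comp (j : ℕ) : Primrec (comp j) := by
  induction j with
  | zero => exact Primrec.fst.comp Primrec.unpair
  | succ j ih => exact ih.comp (Primrec.snd.comp Primrec.unpair)

theorem PrimrecPred.exists_mem_fixed {α β : Type} [Primcodable α] (l : List β)
    {p : β → α → Prop} (h : ∀ b, PrimrecPred (p b)) : PrimrecPred fun a => ∃ b ∈ l, p b a := by
  induction l with
  | nil => exact (Primrec.eq.comp (Primrec.const 0) (Primrec.const 1)).of_eq (by simp)
  | cons b l ih => exact ((h b).or ih).of_eq (by simp)

open Nat.Partrec (Code) in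
theorem primrec_refutes : PrimrecPred fun x : ((ℕ × ℕ) × ℕ) × ℕ =>
    Refutes x.1.1.1 x.1.1.2 x.1.2 fun a => x.2.testBit a = true := by
  let C : ℕ → {f : ℕ → ℕ // Primrec f} := fun j => ⟨comp j, primrec_comp j⟩
  have hx : Primrec fun y : ℕ × (((ℕ × ℕ) × ℕ) × ℕ) => y.2 := Primrec.snd
  have hMb : Primrec fun y : ℕ × (((ℕ × ℕ) × ℕ) × ℕ) => (y.2.1.2, y.2.2) :=
    (Primrec.snd.comp (Primrec.fst.comp hx)).pair (Primrec.snd.comp hx)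
  have hk : Primrec fun y : ℕ × (((ℕ × ℕ) × ℕ) × ℕ) => y.2.1.1.2 :=
    Primrec.snd.comp (Primrec.fst.comp (Primrec.fst.comp hx))
  have hcode : Primrec fun y : ℕ × (((ℕ × ℕ) × ℕ) × ℕ) =>
      (Denumerable.ofNat Code y.2.1.1.1) :=
    (Primrec.ofNat Code).comp (Primrec.fst.comp (Primrec.fst.comp (Primrec.fst.comp hx)))
  have rules : PrimrecPred fun y : ℕ × (((ℕ × ℕ) × ℕ) × ℕ) => ∃ r ∈ Rule.list,
      let c := r.clause (comp 0 y.1) (comp 1 y.1) (comp 2 y.1) (comp 3 y.1) (comp 4 y.1)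
        (comp 5 y.1)
      refuted (fun a => y.2.2.testBit a = true) y.2.1.2 c.1 c.2 := by
    refine .exists_mem_fixed _ fun r => ?_
    refine ((primrec_refuted (r.clause (C 0) (C 1) (C 2) (C 3) (C 4) (C 5)).1
      (r.clause (C 0) (C 1) (C 2) (C 3) (C 4) (C 5)).2).comp
        (hMb.pair Primrec.fst)).of_eq fun y => ?_
    have := r.clause_eval (C 0) (C 1) (C 2) (C 3) (C 4) (C 5) y.1
    simp only [C] at this
    rw [this]
  have goal : PrimrecPred fun y : ℕ × (((ℕ × ℕ) × ℕ) × ℕ) =>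
      refuted (fun a => y.2.2.testBit a = true) y.2.1.2 (goalClause y.2.1.1.2).1
        (goalClause y.2.1.1.2).2 :=
    let k : {f : ℕ → ℕ // Primrec f} := ⟨id, Primrec.id⟩
    (primrec_refuted (goalClause k).1 (goalClause k).2).comp (hMb.pair hk)
  have ax : PrimrecPred fun y : ℕ × (((ℕ × ℕ) × ℕ) × ℕ) =>
      refuted (fun a => y.2.2.testBit a = true) y.2.1.2 (sentenceClause y.2.1.1.2 y.1).1
        (sentenceClause y.2.1.1.2 y.1).2 :=
    let t : {f : ℕ → ℕ // Primrec f} :=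
      ⟨fun n => n.unpair.2, Primrec.snd.comp Primrec.unpair⟩
    ((primrec_refuted (sentenceClause (C 0) t).1 (sentenceClause (C 0) t).2).comp
        (hMb.pair (Primrec₂.natPair.comp hk Primrec.fst))).of_eq fun y => by
      change refuted _ _ [.T (aAgF (Nat.unpair (Nat.pair _ _)).1 eNil eNil)]
        (some (aTr (Nat.unpair (Nat.pair _ _)).2 eNil)) ↔ _
      rw [Nat.unpair_pair]
      rfl
  have halts : PrimrecPred fun y : ℕ × (((ℕ × ℕ) × ℕ) × ℕ) =>
      (Code.evaln y.2.1.2 (Denumerable.ofNat Code y.2.1.1.1) y.1).isSome = true :=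
    Primrec.eq.comp (Primrec.option_isSome.comp (Code.primrec_evaln.comp
      (((Primrec.fst.comp hMb).pair hcode).pair Primrec.fst))) (Primrec.const true)
  have rel : PrimrecRel fun (i : ℕ) (x : ((ℕ × ℕ) × ℕ) × ℕ) => _ :=
    (rules.or (goal.or (halts.and ax))).primrecRel
  exact (rel.exists_mem_list.comp (Primrec.list_range.comp (Primrec.snd.comp Primrec.fst))
    Primrec.id).of_eq fun x => by simp [Refutes]

theorem computable_refutes : ∃ c : Nat.Partrec.Code, ∀ e k : ℕ,
    (c.eval (Nat.pair e k)).Dom ↔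
      ∃ M, ∀ b < 2 ^ M, Refutes e k M fun a => b.testBit a = true := by
  let Q : ℕ → ℕ → Prop := fun n M =>
    ∀ b < 2 ^ M, Refutes n.unpair.1 n.unpair.2 M fun a => b.testBit a = true
  have key : PrimrecRel Q := by
    have rel : PrimrecRel fun (b : ℕ) (y : ℕ × ℕ) =>
        Refutes y.1.unpair.1 y.1.unpair.2 y.2 fun a => b.testBit a = true :=
      primrec_refutes.comp (((Primrec.unpair.comp (Primrec.fst.comp Primrec.snd)).pair
        (Primrec.snd.comp Primrec.snd)).pair Primrec.fst)
    exact (rel.forall_mem_list.comp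
      (Primrec.list_range.comp (primrec_two_pow.comp Primrec.snd)) Primrec.id).of_eq
      fun y => by simp [Q]
  classical
  have hQ : Primrec₂ fun n M => decide (Q n M) := key.decide
  obtain ⟨c, hc⟩ := Nat.Partrec.Code.exists_code.1
    (Partrec.nat_iff.1 (Partrec.rfind hQ.to_comp.partrec₂))
  refine ⟨c, fun e k => ?_⟩
  rw [hc, Nat.rfind_dom']
  simp [Q]

/-- There is an effective procedure (a total computable function on
Gödel numbers) that, given a Gödel number of an r.e. set Σ of 𝓛-sentences, outputs
a Gödel number of the r.e. set `{φ : Σ ⊨ φ}`. -/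
theorem consequences_re_uniform :
    ∃ f : ℕ → ℕ, Computable f ∧
      ∀ (e : ℕ) (T : Set LFormula), (∀ φ ∈ T, φ.fv = ∅) →
        W e = {k : ℕ | ∃ φ ∈ T, k = φ.gnum} →
        W (f e) = {k : ℕ | ∃ φ : LFormula, Consequence T φ ∧ k = φ.gnum} := by
  obtain ⟨c, hc⟩ := computable_refutes
  refine ⟨fun e => Encodable.encode (c.curry e),
    (Primrec.encode.comp (Nat.Partrec.Code.primrec₂_curry.comp (Primrec.const c)
      Primrec.id)).to_comp, fun e T hT he => ?_⟩
  ext k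
  rw [Set.mem_ofPred_eq, consequence_iff hT he, ← hc]
  simp [W, Nat.Partrec.Code.eval_curry]
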